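/- Let (X,f) be a dynamical system and let 𝓕 be a Furstenberg family. Then the following are equivalent: (1) (K(X), f̄) is 𝓕-sensitive; (2) (F^1(X), f̃_g) is 𝓕-sensitive for some g ∈ D_m(I) with g⁻¹(1) = {1}; (3) (F^1(X), f̃_g) is 𝓕-sensitive for every g ∈ D_m(I) with g⁻¹(1) = {1}. -/

import Mathlib

noncomputable section

open Set Metric

/-- The unit interval `I = [0,1]` as a subset of `ℝ`. -/
def I01 : Set ℝ := Set.Icc 0 1

/-- `g ∈ D_m(I)`: `g : I → I` is nondecreasing, right-continuous, `g 0 = 0`, `g 1 = 1`. -/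
def Dm (g : ℝ → ℝ) : Prop :=
  MonotoneOn g I01 ∧
  (∀ x ∈ I01, ContinuousWithinAt g (I01 ∩ Set.Ici x) x) ∧
  Set.MapsTo g I01 I01 ∧ g 0 = 0 ∧ g 1 = 1

/-- `ξ_g x = min g⁻¹([x,1])` (the min exists by right-continuity; `sInf` here). -/
def xiG (g : ℝ → ℝ) (x : ℝ) : ℝ := sInf {t | t ∈ I01 ∧ x ≤ g t}

/-- The `α`-cut `[A]_α` of a fuzzy set `A`. -/
def cut {X : Type*} (A : X → ℝ) (α : ℝ) : Set X := {x | α ≤ A x}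

/-- The support of a fuzzy set. -/
def supp {X : Type*} [TopologicalSpace X] (A : X → ℝ) : Set X := closure {x | 0 < A x}

/-- The `g`-cut `[A]_α^g = {x ∈ supp A : g (A x) ≥ α}`. -/
def gcut {X : Type*} [TopologicalSpace X] (g : ℝ → ℝ) (A : X → ℝ) (α : ℝ) : Set X :=
  {x | x ∈ supp A ∧ α ≤ g (A x)}

/-- `A ∈ F(X)`: an upper semicontinuous fuzzy set on `X`. -/
def IsFuzzy {X : Type*} [TopologicalSpace X] (A : X → ℝ) : Prop :=
  UpperSemicontinuous A ∧ ∀ x, A x ∈ I01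

/-- `A ∈ F_0(X)`: a nonempty (not identically 0) upper semicontinuous fuzzy set. -/
def InF0 {X : Type*} [TopologicalSpace X] (A : X → ℝ) : Prop := IsFuzzy A ∧ ∃ x, A x ≠ 0

/-- `A ∈ F^1(X)`: an upper semicontinuous fuzzy set attaining the value 1. -/
def InF1 {X : Type*} [TopologicalSpace X] (A : X → ℝ) : Prop := IsFuzzy A ∧ ∃ x, 1 ≤ A x

/-- The `g`-fuzzification `f̃_g(A)(x) = sup {g (A y) : y ∈ f⁻¹(x)}` (with `sup ∅ = 0`). -/
def fuzz {X : Type*} (f : X → X) (g : ℝ → ℝ) (A : X → ℝ) : X → ℝ :=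
  fun x => sSup ((fun y => g (A y)) '' (f ⁻¹' {x}))

open Classical in
/-- Hausdorff metric, extended by `d_H(∅,∅) = 0` and `d_H(∅,A) = diam X`. -/
def dH {X : Type*} [MetricSpace X] (A B : Set X) : ℝ :=
  if A = ∅ ∧ B = ∅ then 0
  else if A = ∅ ∨ B = ∅ then Metric.diam (Set.univ : Set X)
  else Metric.hausdorffDist A B

/-- The levelwise metric `d_∞(A,B) = sup {d_H([A]_α, [B]_α) : α ∈ (0,1]}`. -/
def dInfty {X : Type*} [MetricSpace X] (A B : X → ℝ) : ℝ :=
  sSup ((fun α => dH (cut A α) (cut B α)) '' Set.Ioc (0:ℝ) 1)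

/-- `K(X)`: the hyperspace of nonempty compact subsets of `X`. -/
def Kc (X : Type*) [MetricSpace X] : Set (Set X) := {A | IsCompact A ∧ A.Nonempty}

section Dyn

variable {Y : Type*}

/-- `U` is a (relatively) open subset of the space `(S, ρ)`. -/
def IsOpenIn (S : Set Y) (ρ : Y → Y → ℝ) (U : Set Y) : Prop :=
  U ⊆ S ∧ ∀ x ∈ U, ∃ ε > 0, ∀ y ∈ S, ρ x y < ε → y ∈ U

/-- Diameter of a set with respect to the distance function `ρ`. -/
def diamIn (ρ : Y → Y → ℝ) (U : Set Y) : ℝ := sSup (Set.image2 ρ U U)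

/-- Sensitive dependence on initial conditions of `T` on the space `(S, ρ)`. -/
def SensitiveOn (S : Set Y) (ρ : Y → Y → ℝ) (T : Y → Y) : Prop :=
  ∃ δ > 0, ∀ x ∈ S, ∀ ε > 0, ∃ y ∈ S, ρ x y < ε ∧ ∃ n : ℕ, δ < ρ (T^[n] x) (T^[n] y)

/-- `𝓕`-sensitivity of `T` on the space `(S, ρ)`. -/
def FSensitiveOn (S : Set Y) (ρ : Y → Y → ℝ) (T : Y → Y) (F : Set (Set ℕ)) : Prop :=
  ∃ ε > 0, ∀ U : Set Y, IsOpenIn S ρ U → U.Nonempty →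
    {n : ℕ | ε < diamIn ρ (T^[n] '' U)} ∈ F

/-- Multi-sensitivity of `T` on the space `(S, ρ)`. -/
def MultiSensitiveOn (S : Set Y) (ρ : Y → Y → ℝ) (T : Y → Y) : Prop :=
  ∃ ε > 0, ∀ (k : ℕ) (U : Fin k → Set Y),
    (∀ i, IsOpenIn S ρ (U i) ∧ (U i).Nonempty) →
    ∃ n : ℕ, ∀ i, ε < diamIn ρ (T^[n] '' U i)

/-- Topological transitivity of `T` on the space `(S, ρ)`. -/
def TransitiveOn (S : Set Y) (ρ : Y → Y → ℝ) (T : Y → Y) : Prop :=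
  ∀ U V : Set Y, IsOpenIn S ρ U → U.Nonempty → IsOpenIn S ρ V → V.Nonempty →
    ∃ n : ℕ, ((T^[n] '' U) ∩ V).Nonempty

/-- Weak mixing: `T × T` is transitive on `(S × S, max-metric)`. -/
def WeaklyMixingOn (S : Set Y) (ρ : Y → Y → ℝ) (T : Y → Y) : Prop :=
  TransitiveOn (S ×ˢ S) (fun p q => max (ρ p.1 q.1) (ρ p.2 q.2)) (Prod.map T T)

end Dyn

/-- A (proper) Furstenberg family on `ℤ⁺ = ℕ`. -/
def FurstenbergFamily (F : Set (Set ℕ)) : Prop :=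
  (∀ F1 F2 : Set ℕ, F1 ∈ F → F1 ⊆ F2 → F2 ∈ F) ∧ Set.univ ∈ F ∧ ∅ ∉ F

section Hausdorff

variable {X : Type*} [MetricSpace X]

theorem dH_of_nonempty {s t : Set X} (hs : s.Nonempty) (ht : t.Nonempty) :
    dH s t = hausdorffDist s t := by
  simp [dH, hs.ne_empty, ht.ne_empty]

theorem dH_self (s : Set X) : dH s s = 0 := by
  by_cases h : s = ∅ <;> simp [dH, h]

theorem dInfty_le {A B : X → ℝ} {r : ℝ}
    (h : ∀ α ∈ Ioc (0 : ℝ) 1, dH (cut A α) (cut B α) ≤ r) : dInfty A B ≤ r :=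
  csSup_le ⟨_, mem_image_of_mem _ (⟨one_pos, le_rfl⟩ : (1 : ℝ) ∈ Ioc (0 : ℝ) 1)⟩
    (by rintro _ ⟨a, ha, rfl⟩; exact h a ha)

variable [CompactSpace X]

theorem bounded_of_compactSpace (s : Set X) : Bornology.IsBounded s :=
  isCompact_univ.isBounded.subset (subset_univ s)

theorem hausdorffEDist_ne_top_of_compactSpace {s t : Set X} (hs : s.Nonempty)
    (ht : t.Nonempty) : hausdorffEDist s t ≠ ⊤ :=
  hausdorffEDist_ne_top_of_nonempty_of_bounded hs ht (bounded_of_compactSpace s)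
    (bounded_of_compactSpace t)

theorem dH_le_diam (s t : Set X) : dH s t ≤ diam (univ : Set X) := by
  unfold dH
  split_ifs with h1 h2
  · exact diam_nonneg
  · exact le_rfl
  · rw [not_or] at h2
    exact (hausdorffDist_le_diam (nonempty_iff_ne_empty.2 h2.1) (bounded_of_compactSpace s)
      (nonempty_iff_ne_empty.2 h2.2) (bounded_of_compactSpace t)).trans
      (diam_mono (subset_univ _) (bounded_of_compactSpace _))

theorem dH_triangle {s t u : Set X} (hs : s.Nonempty) (ht : t.Nonempty) (hu : u.Nonempty) :
    dH s u ≤ dH s t + dH t u := by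
  rw [dH_of_nonempty hs ht, dH_of_nonempty ht hu, dH_of_nonempty hs hu]
  exact hausdorffDist_triangle (hausdorffEDist_ne_top_of_compactSpace hs ht)

theorem dH_le_dInfty (A B : X → ℝ) {α : ℝ} (hα : α ∈ Ioc (0 : ℝ) 1) :
    dH (cut A α) (cut B α) ≤ dInfty A B :=
  le_csSup ⟨diam (univ : Set X), by rintro _ ⟨a, -, rfl⟩; exact dH_le_diam _ _⟩
    (mem_image_of_mem _ hα)

end Hausdorff

section Diam

variable {Y : Type*}

theorem le_diamIn {ρ : Y → Y → ℝ} {r : ℝ} (hρ : ∀ x y, ρ x y ≤ r) {U : Set Y} {x y : Y}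
    (hx : x ∈ U) (hy : y ∈ U) : ρ x y ≤ diamIn ρ U :=
  le_csSup ⟨r, by rintro _ ⟨a, -, b, -, rfl⟩; exact hρ a b⟩ (mem_image2_of_mem hx hy)

theorem exists_lt_of_lt_diamIn {ρ : Y → Y → ℝ} {r : ℝ} {U : Set Y} (hU : U.Nonempty)
    (h : r < diamIn ρ U) : ∃ x ∈ U, ∃ y ∈ U, r < ρ x y := by
  obtain ⟨_, ⟨x, hx, y, hy, rfl⟩, hr⟩ := exists_lt_of_lt_csSup (hU.image2 hU) h
  exact ⟨x, hx, y, hy, hr⟩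

theorem isOpenIn_ball {S : Set Y} {ρ : Y → Y → ℝ} {x : Y}
    (hρ : ∀ y ∈ S, ∀ z ∈ S, ρ x z ≤ ρ x y + ρ y z) (r : ℝ) :
    IsOpenIn S ρ {y | y ∈ S ∧ ρ x y < r} := by
  refine ⟨fun y hy => hy.1, fun y hy => ⟨r - ρ x y, sub_pos.2 hy.2, fun z hz h => ⟨hz, ?_⟩⟩⟩
  linarith [hρ y hy.1 z hz]

end Diam

section Fuzzy

theorem Dm.exists_le_iff {g : ℝ → ℝ} (hg : Dm g) {α : ℝ} (hα : α ∈ Ioc (0 : ℝ) 1) :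
    ∃ β ∈ Ioc (0 : ℝ) 1, ∀ t ∈ I01, α ≤ g t ↔ β ≤ t := by
  obtain ⟨hmono, hcont, -, h0, h1⟩ := hg
  set S : Set ℝ := {t | t ∈ I01 ∧ α ≤ g t} with hS
  have h1S : (1 : ℝ) ∈ S := ⟨⟨zero_le_one, le_rfl⟩, by rw [h1]; exact hα.2⟩
  have hbdd : BddBelow S := ⟨0, fun t ht => ht.1.1⟩
  have hβ0 : 0 ≤ sInf S := le_csInf ⟨1, h1S⟩ fun t ht => ht.1.1
  have hβ1 : sInf S ≤ 1 := csInf_le hbdd h1S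
  have hβI : sInf S ∈ I01 := ⟨hβ0, hβ1⟩
  have hβ : α ≤ g (sInf S) := by
    have hsub : S ⊆ I01 ∩ Ici (sInf S) := fun t ht => ⟨ht.1, csInf_le hbdd ht⟩
    have hc : ContinuousWithinAt g S (sInf S) := (hcont _ hβI).mono hsub
    exact isClosed_Ici.closure_subset
      (hc.mem_closure (csInf_mem_closure ⟨1, h1S⟩ hbdd) fun t ht => ht.2)
  refine ⟨sInf S, ⟨hβ0.lt_of_ne fun h => ?_, hβ1⟩, fun t ht => ⟨fun h => csInf_le hbdd ⟨ht, h⟩,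
    fun h => hβ.trans (hmono hβI ht h)⟩⟩
  rw [← h, h0] at hβ
  exact hα.1.not_ge hβ

theorem fuzz_eq_zero {X : Type*} {f : X → X} {g : ℝ → ℝ} {A : X → ℝ} {x : X}
    (hx : ¬ (f ⁻¹' {x}).Nonempty) : fuzz f g A x = 0 := by
  rw [not_nonempty_iff_eq_empty] at hx
  simp [fuzz, hx]

variable {X : Type*} [MetricSpace X]

theorem InF1.cut_nonempty {A : X → ℝ} (hA : InF1 A) {α : ℝ} (hα : α ≤ 1) :
    (cut A α).Nonempty := by
  obtain ⟨x, hx⟩ := hA.2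
  exact ⟨x, hα.trans hx⟩

theorem isFuzzy_of_isClosed_cut {A : X → ℝ} (hI : ∀ x, A x ∈ I01)
    (h : ∀ α ∈ Ioc (0 : ℝ) 1, IsClosed (cut A α)) : IsFuzzy A := by
  refine ⟨upperSemicontinuous_iff_isClosed_preimage.2 fun α => ?_, hI⟩
  rcases le_or_gt α 0 with h0 | h0
  · rw [(eq_univ_of_forall fun x => h0.trans (hI x).1 : A ⁻¹' Ici α = univ)]
    exact isClosed_univ
  rcases le_or_gt α 1 with h1 | h1
  · exact h α ⟨h0, h1⟩
  · rw [(eq_empty_of_forall_notMem fun x hx => (h1.trans_le hx).not_ge (hI x).2 :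
      A ⁻¹' Ici α = ∅)]
    exact isClosed_empty

theorem exists_inF1_cut_eq {C : Set X} (hC : C ∈ Kc X) :
    ∃ A : X → ℝ, InF1 A ∧ ∀ α ∈ Ioc (0 : ℝ) 1, cut A α = C := by
  classical
  have hcut : ∀ α ∈ Ioc (0 : ℝ) 1, cut (C.indicator 1) α = C := fun α hα => by
    ext x
    by_cases hx : x ∈ C <;> simp [cut, hx, hα.1, hα.2]
  obtain ⟨x, hx⟩ := hC.2
  refine ⟨C.indicator 1, ⟨isFuzzy_of_isClosed_cut (fun y => ?_) fun α hα => ?_, x, ?_⟩, hcut⟩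
  · by_cases hy : y ∈ C <;> simp [hy, I01]
  · rw [hcut α hα]
    exact hC.1.isClosed
  · simp [hx]

variable [CompactSpace X]

theorem InF1.isCompact_cut {A : X → ℝ} (hA : InF1 A) (α : ℝ) : IsCompact (cut A α) :=
  (upperSemicontinuous_iff_isClosed_preimage.1 hA.1.1 α).isCompact

theorem dInfty_triangle {A B C : X → ℝ} (hA : InF1 A) (hB : InF1 B) (hC : InF1 C) :
    dInfty A C ≤ dInfty A B + dInfty B C :=
  dInfty_le fun _ hα => (dH_triangle (hA.cut_nonempty hα.2) (hB.cut_nonempty hα.2)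
    (hC.cut_nonempty hα.2)).trans (add_le_add (dH_le_dInfty _ _ hα) (dH_le_dInfty _ _ hα))

theorem dInfty_le_diam (A B : X → ℝ) : dInfty A B ≤ diam (univ : Set X) :=
  dInfty_le fun _ _ => dH_le_diam _ _

variable {f : X → X} {g : ℝ → ℝ}

theorem exists_fuzz_eq (hf : Continuous f) (hg : Dm g) {A : X → ℝ} (hA : IsFuzzy A) {x : X}
    (hx : (f ⁻¹' {x}).Nonempty) :
    ∃ y, f y = x ∧ fuzz f g A x = g (A y) ∧ ∀ z, f z = x → g (A z) ≤ g (A y) := by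
  obtain ⟨y, hy, hmax⟩ := (hA.1.upperSemicontinuousOn (f ⁻¹' {x})).exists_isMaxOn hx
    (isClosed_singleton.preimage hf).isCompact
  have hle : ∀ z, f z = x → g (A z) ≤ g (A y) := fun z hz =>
    hg.1 (hA.2 z) (hA.2 y) (hmax hz)
  refine ⟨y, hy, IsGreatest.csSup_eq ⟨mem_image_of_mem _ hy, ?_⟩, hle⟩
  rintro _ ⟨z, hz, rfl⟩
  exact hle z hz

theorem cut_fuzz (hf : Continuous f) (hg : Dm g) {A : X → ℝ} (hA : IsFuzzy A) {α β : ℝ}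
    (hα : 0 < α) (h : ∀ t ∈ I01, α ≤ g t ↔ β ≤ t) : cut (fuzz f g A) α = f '' cut A β := by
  ext x
  constructor
  · intro hx
    by_cases hne : (f ⁻¹' {x}).Nonempty
    · obtain ⟨y, hy, he, -⟩ := exists_fuzz_eq hf hg hA hne
      exact ⟨y, (h _ (hA.2 y)).1 (he ▸ hx), hy⟩
    · have hx' : α ≤ fuzz f g A x := hx
      rw [fuzz_eq_zero hne] at hx'
      exact absurd hx' hα.not_ge
  · rintro ⟨z, hz, hzx⟩
    obtain ⟨y, -, he, hmax⟩ := exists_fuzz_eq hf hg hA ⟨z, hzx⟩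
    change α ≤ fuzz f g A x
    rw [he]
    exact ((h _ (hA.2 z)).2 hz).trans (hmax z hzx)

theorem InF1.fuzz (hf : Continuous f) (hg : Dm g) {A : X → ℝ} (hA : InF1 A) :
    InF1 (fuzz f g A) := by
  refine ⟨isFuzzy_of_isClosed_cut (fun x => ?_) fun α hα => ?_, ?_⟩
  · by_cases hne : (f ⁻¹' {x}).Nonempty
    · obtain ⟨y, -, he, -⟩ := exists_fuzz_eq hf hg hA.1 hne
      rw [he]
      exact hg.2.2.1 (hA.1.2 y)
    · rw [fuzz_eq_zero hne]
      exact ⟨le_rfl, zero_le_one⟩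
  · obtain ⟨β, -, h⟩ := hg.exists_le_iff hα
    rw [cut_fuzz hf hg hA.1 hα.1 h]
    exact ((hA.isCompact_cut β).image hf).isClosed
  · obtain ⟨β, hβ, h⟩ := hg.exists_le_iff (α := 1) ⟨one_pos, le_rfl⟩
    have hne := (hA.cut_nonempty hβ.2).image f
    rwa [← cut_fuzz hf hg hA.1 one_pos h] at hne

theorem exists_cut_fuzz_iterate (hf : Continuous f) (hg : Dm g)
    (hg1 : ∀ t ∈ I01, (g t = 1 ↔ t = 1)) (n : ℕ) {α : ℝ} (hα : α ∈ Ioc (0 : ℝ) 1) :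
    ∃ β ∈ Ioc (0 : ℝ) 1, (α = 1 → β = 1) ∧
      ∀ A : X → ℝ, InF1 A → cut ((_root_.fuzz f g)^[n] A) α = f^[n] '' cut A β := by
  induction n generalizing α with
  | zero => exact ⟨α, hα, id, fun A _ => by simp⟩
  | succ n ih =>
    obtain ⟨β, hβ, hβ1, hcut⟩ := ih hα
    obtain ⟨γ, hγ, hγ1, h⟩ : ∃ γ ∈ Ioc (0 : ℝ) 1, (β = 1 → γ = 1) ∧
        ∀ t ∈ I01, β ≤ g t ↔ γ ≤ t := by
      rcases eq_or_ne β 1 with rfl | hne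
      · refine ⟨1, hβ, id, fun t ht => ?_⟩
        rw [(hg.2.2.1 ht).2.ge_iff_eq', ht.2.ge_iff_eq', eq_comm, hg1 t ht, eq_comm]
      · obtain ⟨γ, hγ, h⟩ := hg.exists_le_iff hβ
        exact ⟨γ, hγ, fun h => absurd h hne, h⟩
    refine ⟨γ, hγ, hγ1 ∘ hβ1, fun A hA => ?_⟩
    rw [Function.iterate_succ_apply, hcut _ (hA.fuzz hf hg), cut_fuzz hf hg hA.1 hβ.1 h,
      Function.iterate_succ, image_comp]

theorem InF1.exists_cut_near {A : X → ℝ} (hA : InF1 A) {δ : ℝ} (hδ : 0 < δ) :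
    ∃ β ∈ Ioo (0 : ℝ) 1, ∀ x, β ≤ A x → ∃ y ∈ cut A 1, dist x y < δ := by
  have hne := hA.cut_nonempty le_rfl
  obtain ⟨β, hβ, h⟩ : ∃ β ∈ Ioo (0 : ℝ) 1, ∀ x, δ ≤ infDist x (cut A 1) → A x < β := by
    rcases {x | δ ≤ infDist x (cut A 1)}.eq_empty_or_nonempty with he | hn
    · refine ⟨1 / 2, by norm_num, fun x hx => ?_⟩
      have : x ∈ {x | δ ≤ infDist x (cut A 1)} := hx
      simp [he] at this
    · obtain ⟨y, hy, hmax⟩ := (hA.1.1.upperSemicontinuousOn _).exists_isMaxOn hn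
        (isClosed_le continuous_const (continuous_infDist_pt _)).isCompact
      have hy1 : A y < 1 := by
        by_contra! hc
        have hy' : δ ≤ infDist y (cut A 1) := hy
        rw [infDist_zero_of_mem (show y ∈ cut A 1 from hc)] at hy'
        exact hδ.not_ge hy'
      have hy0 := (hA.1.2 y).1
      refine ⟨(1 + A y) / 2, ⟨by linarith, by linarith⟩, fun x hx => ?_⟩
      have : A x ≤ A y := hmax hx
      linarith
  refine ⟨β, hβ, fun x hx => (infDist_lt_iff hne).1 ?_⟩
  by_contra! hc
  exact hx.not_gt (h x hc)

theorem InF1.exists_cut_one_eq {A : X → ℝ} (hA : InF1 A) {δ : ℝ} (hδ : 0 < δ) {C : Set X}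
    (hC : C ∈ Kc X) (hAC : dH (cut A 1) C < δ) :
    ∃ B, InF1 B ∧ cut B 1 = C ∧ dInfty A B ≤ 2 * δ := by
  classical
  obtain ⟨β, hβ, hnear⟩ := hA.exists_cut_near hδ
  have hne := hA.cut_nonempty le_rfl
  have hfin := hausdorffEDist_ne_top_of_compactSpace hne hC.2
  rw [dH_of_nonempty hne hC.2] at hAC
  let B : X → ℝ := fun x => if x ∈ C then 1 else min (A x) β
  have hhigh : ∀ α ≤ 1, β < α → cut B α = C := fun α h1 hα => by
    ext x
    by_cases hx : x ∈ C <;> simp [cut, B, hx, h1, hα]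
  have hlow : ∀ α ≤ β, cut B α = C ∪ cut A α := fun α hα => by
    ext x
    by_cases hx : x ∈ C <;> simp [cut, B, hx, hα, hα.trans hβ.2.le]
  have hB1 : cut B 1 = C := hhigh 1 le_rfl hβ.2
  refine ⟨B, ⟨isFuzzy_of_isClosed_cut (fun x => ?_) fun α hα => ?_, ?_⟩, hB1,
    dInfty_le fun α hα => ?_⟩
  · by_cases hx : x ∈ C
    · simp [B, hx, I01]
    · simp only [B, hx, if_false]
      exact ⟨le_min (hA.1.2 x).1 hβ.1.le, (min_le_left _ _).trans (hA.1.2 x).2⟩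
  · rcases le_or_gt α β with h | h
    · rw [hlow α h]
      exact hC.1.isClosed.union (hA.isCompact_cut α).isClosed
    · rw [hhigh α hα.2 h]
      exact hC.1.isClosed
  · obtain ⟨x, hx⟩ := hC.2
    exact ⟨x, by simp [B, hx]⟩
  · have hCA : ∀ x ∈ C, ∃ y ∈ cut A α, dist x y ≤ 2 * δ := fun x hx => by
      obtain ⟨y, hy, hd⟩ := exists_dist_lt_of_hausdorffDist_lt' hx hAC hfin
      rw [dist_comm] at hd
      exact ⟨y, hα.2.trans hy, by linarith⟩
    rcases le_or_gt α β with h | h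
    · rw [hlow α h, dH_of_nonempty (hA.cut_nonempty hα.2) (hC.2.inl)]
      refine hausdorffDist_le_of_mem_dist (by linarith)
        (fun x hx => ⟨x, Or.inr hx, by rw [dist_self]; linarith⟩) ?_
      rintro x (hx | hx)
      · exact hCA x hx
      · exact ⟨x, hx, by rw [dist_self]; linarith⟩
    · rw [hhigh α hα.2 h, dH_of_nonempty (hA.cut_nonempty hα.2) hC.2]
      refine hausdorffDist_le_of_mem_dist (by linarith) (fun x hx => ?_) hCA
      obtain ⟨y, hy, hxy⟩ := hnear x (h.le.trans hx)
      obtain ⟨z, hz, hyz⟩ := exists_dist_lt_of_hausdorffDist_lt hy hAC hfin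
      exact ⟨z, hz, by linarith [dist_triangle x y z]⟩

theorem FSensitiveOn.hyperspace (hf : Continuous f) {F : Set (Set ℕ)}
    (hF : FurstenbergFamily F) (hg : Dm g) (hg1 : ∀ t ∈ I01, (g t = 1 ↔ t = 1))
    (h : FSensitiveOn {A : X → ℝ | InF1 A} dInfty (_root_.fuzz f g) F) :
    FSensitiveOn (Kc X) dH (image f) F := by
  obtain ⟨ε, hε, h⟩ := h
  refine ⟨ε, hε, fun U hU hUne => ?_⟩
  obtain ⟨C, hCU⟩ := hUne
  obtain ⟨δ, hδ, hball⟩ := hU.2 C hCU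
  obtain ⟨A, hA, hcut⟩ := exists_inF1_cut_eq (hU.1 hCU)
  have hmem : ∀ B, InF1 B → dInfty A B < δ → ∀ α ∈ Ioc (0 : ℝ) 1, cut B α ∈ U :=
    fun B hB hAB α hα => hball _ ⟨hB.isCompact_cut α, hB.cut_nonempty hα.2⟩
      (((hcut α hα).symm ▸ dH_le_dInfty A B hα).trans_lt hAB)
  have hne : {B | B ∈ {B : X → ℝ | InF1 B} ∧ dInfty A B < δ}.Nonempty :=
    ⟨A, hA, (dInfty_le fun α _ => (dH_self _).le).trans_lt hδ⟩
  refine hF.1 _ _ (h _ (isOpenIn_ball (fun B hB D hD => dInfty_triangle hA hB hD) δ) hne)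
    fun n hn => ?_
  obtain ⟨_, ⟨B, hB, rfl⟩, _, ⟨D, hD, rfl⟩, hlt⟩ := exists_lt_of_lt_diamIn (hne.image _) hn
  by_contra hc
  refine hlt.not_ge (dInfty_le fun α hα => ?_)
  obtain ⟨β, hβ, -, hiter⟩ := exists_cut_fuzz_iterate hf hg hg1 n hα
  rw [hiter B hB.1, hiter D hD.1]
  refine le_trans (le_diamIn dH_le_diam ?_ ?_) (not_lt.1 hc)
  · exact ⟨_, hmem B hB.1 hB.2 β hβ, image_iterate_eq.symm ▸ rfl⟩
  · exact ⟨_, hmem D hD.1 hD.2 β hβ, image_iterate_eq.symm ▸ rfl⟩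

theorem FSensitiveOn.fuzzification (hf : Continuous f) {F : Set (Set ℕ)}
    (hF : FurstenbergFamily F) (hg : Dm g) (hg1 : ∀ t ∈ I01, (g t = 1 ↔ t = 1))
    (h : FSensitiveOn (Kc X) dH (image f) F) :
    FSensitiveOn {A : X → ℝ | InF1 A} dInfty (_root_.fuzz f g) F := by
  obtain ⟨ε, hε, h⟩ := h
  refine ⟨ε, hε, fun U hU hUne => ?_⟩
  obtain ⟨A, hAU⟩ := hUne
  obtain ⟨δ, hδ, hball⟩ := hU.2 A hAU
  have hA : InF1 A := hU.1 hAU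
  have hA1 := hA.cut_nonempty le_rfl
  have hne : {C | C ∈ Kc X ∧ dH (cut A 1) C < δ / 4}.Nonempty :=
    ⟨cut A 1, ⟨hA.isCompact_cut 1, hA1⟩, by rw [dH_self]; linarith⟩
  refine hF.1 _ _ (h _ (isOpenIn_ball (fun B hB D hD => dH_triangle hA1 hB.2 hD.2) (δ / 4)) hne)
    fun n hn => ?_
  have hone : (1 : ℝ) ∈ Ioc (0 : ℝ) 1 := ⟨one_pos, le_rfl⟩
  obtain ⟨β, -, hβ, hiter⟩ := exists_cut_fuzz_iterate hf hg hg1 n hone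
  obtain rfl := hβ rfl
  have hlift : ∀ C, C ∈ Kc X → dH (cut A 1) C < δ / 4 →
      ∃ B ∈ U, cut ((_root_.fuzz f g)^[n] B) 1 = (image f)^[n] C := fun C hC hAC => by
    obtain ⟨B, hB, hB1, hd⟩ := hA.exists_cut_one_eq (by linarith) hC hAC
    exact ⟨B, hball B hB (by linarith), by rw [hiter B hB, hB1, image_iterate_eq]⟩
  obtain ⟨_, ⟨C, hC, rfl⟩, _, ⟨D, hD, rfl⟩, hlt⟩ := exists_lt_of_lt_diamIn (hne.image _) hn
  obtain ⟨B, hBU, hB⟩ := hlift C hC.1 hC.2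
  obtain ⟨E, hEU, hE⟩ := hlift D hD.1 hD.2
  rw [← hB, ← hE] at hlt
  exact hlt.trans_le ((dH_le_dInfty _ _ hone).trans
    (le_diamIn dInfty_le_diam (mem_image_of_mem _ hBU) (mem_image_of_mem _ hEU)))

end Fuzzy

/-- For a Furstenberg family `𝓕`, TFAE: (1) `(K(X), f̄)` is
`𝓕`-sensitive; (2) `(F^1(X), f̃_g)` is `𝓕`-sensitive for some `g ∈ D_m(I)` with
`g⁻¹(1) = {1}`; (3) the same for every such `g`. -/
theorem stmt11 {X : Type*} [MetricSpace X] [CompactSpace X]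
    (f : X → X) (hf : Continuous f)
    (F : Set (Set ℕ)) (hF : FurstenbergFamily F) :
    List.TFAE
      [FSensitiveOn (Kc X) dH (Set.image f) F,
       ∃ g : ℝ → ℝ, Dm g ∧ (∀ t ∈ I01, (g t = 1 ↔ t = 1)) ∧
         FSensitiveOn {A : X → ℝ | InF1 A} dInfty (fuzz f g) F,
       ∀ g : ℝ → ℝ, Dm g → (∀ t ∈ I01, (g t = 1 ↔ t = 1)) →
         FSensitiveOn {A : X → ℝ | InF1 A} dInfty (fuzz f g) F] := by
  tfae_have 3 → 2 := fun h => ⟨id, ⟨monotoneOn_id, fun _ _ => continuousWithinAt_id, mapsTo_id _,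
    rfl, rfl⟩, fun _ _ => Iff.rfl, h id ⟨monotoneOn_id, fun _ _ => continuousWithinAt_id,
    mapsTo_id _, rfl, rfl⟩ fun _ _ => Iff.rfl⟩
  tfae_have 2 → 1 := fun ⟨_, hg, hg1, h⟩ => h.hyperspace hf hF hg hg1
  tfae_have 1 → 3 := fun h _ hg hg1 => h.fuzzification hf hF hg hg1
  tfae_finish
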